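/- arXiv:1709.09568 — 2 statements merged into one kernel-verified Lean document; each statement's English description precedes it below -/
import Mathlib

section
/- (Lemma 2.1) Let M ∈ ℝ, let V : ℝ × ℝ³ → ℝ be continuous, and let ψ : ℝ × ℝ³ → ℂ⁴ be of class C¹, compactly supported in space (there exists R > 0 with ψ(t,x) = 0 whenever |x| ≥ R), and satisfy −i γ⁰ ∂_t ψ − i ∑_{j=1}^{3} γ^j ∂_{x_j} ψ + M ψ = V ψ pointwise. Then for every z ∈ ℂ and every t ∈ ℝ, ∫_{ℝ³} |ψ(t,x) + z γ² ψ*(t,x)|² dx = ∫_{ℝ³} |ψ(0,x) + z γ² ψ*(0,x)|² dx. -/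
open Matrix Complex

noncomputable section

/-- The Dirac gamma matrix `γ⁰` in the Dirac representation. -/
def γ0 : Matrix (Fin 4) (Fin 4) ℂ :=
  !![1, 0, 0, 0; 0, 1, 0, 0; 0, 0, -1, 0; 0, 0, 0, -1]

/-- The Dirac gamma matrix `γ¹` in the Dirac representation. -/
def γ1 : Matrix (Fin 4) (Fin 4) ℂ :=
  !![0, 0, 0, 1; 0, 0, 1, 0; 0, -1, 0, 0; -1, 0, 0, 0]

/-- The Dirac gamma matrix `γ²` in the Dirac representation. -/
def γ2 : Matrix (Fin 4) (Fin 4) ℂ :=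
  !![0, 0, 0, -I; 0, 0, I, 0; 0, I, 0, 0; -I, 0, 0, 0]

/-- The Dirac gamma matrix `γ³` in the Dirac representation. -/
def γ3 : Matrix (Fin 4) (Fin 4) ℂ :=
  !![0, 0, 1, 0; 0, 0, 0, -1; -1, 0, 0, 0; 0, 1, 0, 0]

/-- All four gamma matrices `γ⁰, γ¹, γ², γ³`. -/
def γmat : Fin 4 → Matrix (Fin 4) (Fin 4) ℂ := ![γ0, γ1, γ2, γ3]

/-- The three spatial gamma matrices `γ¹, γ², γ³`. -/
def γsp : Fin 3 → Matrix (Fin 4) (Fin 4) ℂ := ![γ1, γ2, γ3]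

/-- Spacetime `ℝ × ℝ³`. -/
abbrev Spacetime := ℝ × EuclideanSpace ℝ (Fin 3)

/-- The Dirac operator applied to a spinor field `ψ` at a point `p`:
`−i γ⁰ ∂_t ψ − i ∑_{j=1}^{3} γ^j ∂_{x_j} ψ + M ψ` at `p`. -/
def diracOp (M : ℝ) (ψ : Spacetime → Fin 4 → ℂ) (p : Spacetime) : Fin 4 → ℂ :=
  -(Complex.I • (γ0 *ᵥ fderiv ℝ ψ p (1, 0)))
    - Complex.I • ∑ j : Fin 3, γsp j *ᵥ fderiv ℝ ψ p (0, EuclideanSpace.single j 1)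
    + (M : ℂ) • ψ p

open MeasureTheory Filter Topology
open scoped ComplexConjugate

/-- The real-linear map `φ ↦ φ + z γ² φ*` on spinors. -/
def majoranaMap (z : ℂ) : (Fin 4 → ℂ) →L[ℝ] (Fin 4 → ℂ) :=
  LinearMap.toContinuousLinearMap
    { toFun := fun φ => φ + z • (γ2 *ᵥ star φ)
      map_add' := fun a b => by
        rw [star_add, mulVec_add, smul_add]
        abel
      map_smul' := fun r a => by
        rw [star_smul, star_trivial, mulVec_smul, smul_comm z r, RingHom.id_apply, smul_add] }

lemma majoranaMap_apply (z : ℂ) (φ : Fin 4 → ℂ) :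
    majoranaMap z φ = φ + z • (γ2 *ᵥ star φ) := rfl

/-- The Dirac equation with real mass `m` at a point, for the value `φ` of the field, its time
derivative `a` and its spatial derivatives `b`. -/
def DiracRelation (m : ℝ) (φ a : Fin 4 → ℂ) (b : Fin 3 → Fin 4 → ℂ) : Prop :=
  -(I • (γ0 *ᵥ a)) - I • ∑ j : Fin 3, γsp j *ᵥ b j + (m : ℂ) • φ = 0

lemma diracRelation_iff (m : ℝ) (φ a : Fin 4 → ℂ) (b : Fin 3 → Fin 4 → ℂ) :
    DiracRelation m φ a b ↔
      (-(I * a 0) - I * (b 0 3 - I * b 1 3 + b 2 2) + m * φ 0 = 0 ∧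
       -(I * a 1) - I * (b 0 2 + I * b 1 2 - b 2 3) + m * φ 1 = 0 ∧
       I * a 2 + I * (b 0 1 - I * b 1 1 + b 2 0) + m * φ 2 = 0 ∧
       I * a 3 + I * (b 0 0 + I * b 1 0 - b 2 1) + m * φ 3 = 0) := by
  rw [DiracRelation, funext_iff, Fin.forall_fin_succ, Fin.forall_fin_succ, Fin.forall_fin_succ,
    Fin.forall_fin_one]
  simp only [γ0, γsp, γ1, γ2, γ3, mulVec, dotProduct, Fin.sum_univ_four, Fin.sum_univ_three,
    Pi.add_apply, Pi.sub_apply, Pi.neg_apply, Pi.smul_apply, Pi.zero_apply, smul_eq_mul]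
  simp
  refine and_congr ?_ (and_congr ?_ (and_congr ?_ ?_)) <;>
    (apply Eq.congr_left; ring)

lemma DiracRelation.majoranaMap {m : ℝ} {φ a : Fin 4 → ℂ} {b : Fin 3 → Fin 4 → ℂ}
    (h : DiracRelation m φ a b) (z : ℂ) :
    DiracRelation m (majoranaMap z φ) (majoranaMap z a) fun j => majoranaMap z (b j) := by
  rw [diracRelation_iff] at h ⊢
  obtain ⟨h0, h1, h2, h3⟩ := h
  have c0 := congrArg star h0
  have c1 := congrArg star h1
  have c2 := congrArg star h2
  have c3 := congrArg star h3
  simp at c0 c1 c2 c3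
  simp [majoranaMap_apply, γ2, dotProduct, Fin.sum_univ_four]
  refine ⟨?_, ?_, ?_, ?_⟩
  · linear_combination h0 - z * I * c3
  · linear_combination h1 + z * I * c2
  · linear_combination h2 + z * I * c1
  · linear_combination h3 - z * I * c0

/-- The real part of the sesquilinear form `φ† B χ`. -/
def sesqRe (B : Matrix (Fin 4) (Fin 4) ℂ) (φ χ : Fin 4 → ℂ) : ℝ :=
  (star φ ⬝ᵥ B *ᵥ χ).re

@[simp] lemma sesqRe_zero_left (B : Matrix (Fin 4) (Fin 4) ℂ) (χ : Fin 4 → ℂ) :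
    sesqRe B 0 χ = 0 := by
  simp [sesqRe]

@[simp] lemma sesqRe_zero_right (B : Matrix (Fin 4) (Fin 4) ℂ) (φ : Fin 4 → ℂ) :
    sesqRe B φ 0 = 0 := by
  simp [sesqRe]

lemma sesqRe_one_self (φ : Fin 4 → ℂ) : sesqRe 1 φ φ = ∑ i, normSq (φ i) := by
  simp [sesqRe, dotProduct, normSq_apply]

lemma Continuous.sesqRe {X : Type*} [TopologicalSpace X] (B : Matrix (Fin 4) (Fin 4) ℂ)
    {f g : X → Fin 4 → ℂ} (hf : Continuous f) (hg : Continuous g) :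
    Continuous fun x => sesqRe B (f x) (g x) :=
  continuous_re.comp (hf.star.dotProduct (continuous_const.matrix_mulVec hg))

lemma HasDerivAt.sesqRe_self (B : Matrix (Fin 4) (Fin 4) ℂ) {c : ℝ → Fin 4 → ℂ}
    {c' : Fin 4 → ℂ} {s : ℝ} (hc : HasDerivAt c c' s) :
    HasDerivAt (fun s => sesqRe B (c s) (c s)) (sesqRe B c' (c s) + sesqRe B (c s) c') s := by
  have hi (i) := hasDerivAt_pi.1 hc i
  have key : HasDerivAt (fun s => ∑ i, star (c s i) * ∑ j, B i j * c s j)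
      (∑ i, (star (c' i) * ∑ j, B i j * c s j + star (c s i) * ∑ j, B i j * c' j)) s :=
    HasDerivAt.fun_sum fun i _ => (hi i).star.mul
      (HasDerivAt.fun_sum fun j _ => (hi j).const_mul (B i j))
  have := (reCLM.hasFDerivAt (x := ∑ i, star (c s i) * ∑ j, B i j * c s j)).comp_hasDerivAt s key
  refine this.congr_deriv ?_
  simp only [sesqRe, dotProduct, mulVec, Finset.sum_add_distrib, map_add, reCLM_apply,
    Pi.star_apply]

lemma DiracRelation.divergence_eq_zero {m : ℝ} {φ a : Fin 4 → ℂ} {b : Fin 3 → Fin 4 → ℂ}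
    (h : DiracRelation m φ a b) :
    (sesqRe 1 a φ + sesqRe 1 φ a)
      + ∑ j, (sesqRe (γ0 * γsp j) (b j) φ + sesqRe (γ0 * γsp j) φ (b j)) = 0 := by
  rw [diracRelation_iff] at h
  obtain ⟨h0, h1, h2, h3⟩ := h
  have c0 := congrArg star h0
  have c1 := congrArg star h1
  have c2 := congrArg star h2
  have c3 := congrArg star h3
  simp at c0 c1 c2 c3
  simp only [sesqRe, ← add_re, ← re_sum]
  rw [← zero_re]
  congr 1
  simp [γ0, γsp, γ1, γ2, γ3, mulVec, dotProduct, Fin.sum_univ_four, Fin.sum_univ_three,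
    vecMul]
  linear_combination
    I * (conj (φ 0) * h0 + conj (φ 1) * h1 - conj (φ 2) * h2 - conj (φ 3) * h3)
    - I * (φ 0 * c0 + φ 1 * c1 - φ 2 * c2 - φ 3 * c3)
    + (conj (φ 0) * (a 0 + b 0 3 - I * b 1 3 + b 2 2)
      + conj (φ 1) * (a 1 + b 0 2 + I * b 1 2 - b 2 3)
      + conj (φ 2) * (a 2 + b 0 1 - I * b 1 1 + b 2 0)
      + conj (φ 3) * (a 3 + b 0 0 + I * b 1 0 - b 2 1)
      + φ 0 * (conj (a 0) + conj (b 0 3) + I * conj (b 1 3) + conj (b 2 2))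
      + φ 1 * (conj (a 1) + conj (b 0 2) - I * conj (b 1 2) - conj (b 2 3))
      + φ 2 * (conj (a 2) + conj (b 0 1) + I * conj (b 1 1) + conj (b 2 0))
      + φ 3 * (conj (a 3) + conj (b 0 0) - I * conj (b 1 0) - conj (b 2 1))) * I_sq

/-- The line derivative of an integrable function has integral zero if it is integrable. -/
lemma integral_hasLineDerivAt_eq_zero {E : Type*} [NormedAddCommGroup E] [NormedSpace ℝ E]
    [FiniteDimensional ℝ E] [MeasurableSpace E] [BorelSpace E] (μ : Measure E) [μ.IsAddHaarMeasure]
    {f f' : E → ℝ} {v : E} (hf : Integrable f μ) (hf' : Integrable f' μ)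
    (h : ∀ x, HasLineDerivAt ℝ f (f' x) x v) : ∫ x, f' x ∂μ = 0 := by
  have := integral_bilinear_hasLineDerivAt_right_eq_neg_left_of_integrable (μ := μ)
    (f := fun _ : E => (1 : ℝ)) (f' := fun _ => 0) (g := f) (g' := f') (v := v)
    (B := ContinuousLinearMap.mul ℝ ℝ) (by simp) (by simpa using hf') (by simpa using hf)
    (fun x _ => hasDerivAt_const _ _) (fun x _ => h x)
  simpa using this

/-- Differentiation under the integral sign for families of functions supported in a fixed
ball. -/
lemma hasDerivAt_integral_of_continuous_of_eq_zero {E : Type*} [NormedAddCommGroup E]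
    [NormedSpace ℝ E] [FiniteDimensional ℝ E] [MeasurableSpace E] [BorelSpace E] (μ : Measure E)
    [IsFiniteMeasureOnCompacts μ] {F F' : ℝ × E → ℝ} {R : ℝ}
    (hF : Continuous F) (hF' : Continuous F')
    (hF0 : ∀ t x, R ≤ ‖x‖ → F (t, x) = 0) (hF'0 : ∀ t x, R ≤ ‖x‖ → F' (t, x) = 0)
    (hd : ∀ t x, HasDerivAt (fun s => F (s, x)) (F' (t, x)) t) (t : ℝ) :
    HasDerivAt (fun s => ∫ x, F (s, x) ∂μ) (∫ x, F' (t, x) ∂μ) t := by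
  obtain ⟨C, hC⟩ := ((isCompact_closedBall t 1).prod
    (isCompact_closedBall (0 : E) R)).exists_bound_of_continuousOn hF'.continuousOn
  have hcs : HasCompactSupport fun x => F (t, x) :=
    HasCompactSupport.intro (isCompact_closedBall (0 : E) R) fun x hx =>
      hF0 t x (by simpa using (not_le.1 (by simpa using hx : ¬ ‖x‖ ≤ R)).le)
  refine (hasDerivAt_integral_of_dominated_loc_of_deriv_le
    (F := fun s x => F (s, x)) (F' := fun s x => F' (s, x))
    (bound := (Metric.closedBall (0 : E) R).indicator fun _ => C)
    (Metric.closedBall_mem_nhds t one_pos)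
    (Eventually.of_forall fun s => (hF.comp (by fun_prop)).aestronglyMeasurable)
    ((hF.comp (by fun_prop : Continuous fun x => (t, x))).integrable_of_hasCompactSupport hcs)
    (hF'.comp (by fun_prop : Continuous fun x => (t, x))).aestronglyMeasurable
    (Eventually.of_forall fun x s hs => ?_) ?_
    (Eventually.of_forall fun x s _ => hd s x)).2
  · by_cases hx : x ∈ Metric.closedBall (0 : E) R
    · rw [Set.indicator_of_mem hx]
      exact hC (s, x) ⟨hs, hx⟩
    · rw [Set.indicator_of_notMem hx, hF'0 s x (not_le.1 (by simpa using hx : ¬ ‖x‖ ≤ R)).le,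
        norm_zero]
  · rw [integrable_indicator_iff measurableSet_closedBall]
    exact integrableOn_const (isCompact_closedBall (0 : E) R).measure_lt_top.ne

/-- Charge conservation for continuously differentiable, spatially compactly supported solutions
of the Dirac equation with a real scalar potential. -/
lemma integral_normSq_eq_of_diracRelation {φ : Spacetime → Fin 4 → ℂ} (hφ : ContDiff ℝ 1 φ)
    {R : ℝ} (hsupp : ∀ (t : ℝ) (x : EuclideanSpace ℝ (Fin 3)), R ≤ ‖x‖ → φ (t, x) = 0)
    {m : Spacetime → ℝ}
    (h : ∀ p, DiracRelation (m p) (φ p) (fderiv ℝ φ p (1, 0))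
      fun j => fderiv ℝ φ p (0, EuclideanSpace.single j 1)) (t : ℝ) :
    ∫ x : EuclideanSpace ℝ (Fin 3), ∑ i, normSq (φ (t, x) i)
      = ∫ x : EuclideanSpace ℝ (Fin 3), ∑ i, normSq (φ (0, x) i) := by
  have hline (p v : Spacetime) (B) : HasLineDerivAt ℝ (fun p => sesqRe B (φ p) (φ p))
      (sesqRe B (fderiv ℝ φ p v) (φ p) + sesqRe B (φ p) (fderiv ℝ φ p v)) p v := by
    have := (((hφ.differentiable one_ne_zero p).hasFDerivAt.hasLineDerivAt v :)
      : HasDerivAt _ _ _).sesqRe_self B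
    simpa [HasLineDerivAt] using this
  have hcont (v : Spacetime) (B) : Continuous fun p =>
      sesqRe B (fderiv ℝ φ p v) (φ p) + sesqRe B (φ p) (fderiv ℝ φ p v) := by
    have hv : Continuous fun p => fderiv ℝ φ p v :=
      (hφ.continuous_fderiv one_ne_zero).clm_apply continuous_const
    exact (hv.sesqRe B hφ.continuous).add (hφ.continuous.sesqRe B hv)
  have hint (F : Spacetime → ℝ) (hF : Continuous F)
      (hF0 : ∀ (t : ℝ) (x : EuclideanSpace ℝ (Fin 3)), R ≤ ‖x‖ → F (t, x) = 0) (t : ℝ) :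
      Integrable fun x => F (t, x) :=
    (hF.comp (by fun_prop : Continuous fun x => (t, x))).integrable_of_hasCompactSupport
      (HasCompactSupport.intro (isCompact_closedBall 0 R) fun x hx =>
        hF0 t x (not_le.1 (by simpa using hx : ¬ ‖x‖ ≤ R)).le)
  have hspace (t : ℝ) (j : Fin 3) (B) : ∫ x : EuclideanSpace ℝ (Fin 3),
      (sesqRe B (fderiv ℝ φ (t, x) (0, EuclideanSpace.single j 1)) (φ (t, x))
        + sesqRe B (φ (t, x)) (fderiv ℝ φ (t, x) (0, EuclideanSpace.single j 1))) = 0 := by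
    refine integral_hasLineDerivAt_eq_zero volume (f := fun x => sesqRe B (φ (t, x)) (φ (t, x)))
      (v := EuclideanSpace.single j 1)
      (hint _ (hφ.continuous.sesqRe B hφ.continuous) (fun s x hx => by simp [hsupp s x hx]) t)
      (hint _ (hcont (0, EuclideanSpace.single j 1) B) (fun s x hx => by simp [hsupp s x hx]) t)
      fun x => ?_
    simpa [HasLineDerivAt] using hline (t, x) (0, EuclideanSpace.single j 1) B
  have htime (t : ℝ) : HasDerivAt
      (fun s => ∫ x : EuclideanSpace ℝ (Fin 3), sesqRe 1 (φ (s, x)) (φ (s, x))) 0 t := by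
    have key := hasDerivAt_integral_of_continuous_of_eq_zero volume
      (F := fun p => sesqRe 1 (φ p) (φ p)) (R := R)
      (hφ.continuous.sesqRe 1 hφ.continuous) (hcont (1, 0) 1)
      (fun s x hx => by simp [hsupp s x hx]) (fun s x hx => by simp [hsupp s x hx])
      (fun s x => by
        have hl : HasDerivAt _ _ _ := hline (s, x) (1, 0) 1
        have e (r : ℝ) : ((s, x) : Spacetime) + (r - s) • (1, 0) = (r, x) := by simp
        exact (HasDerivAt.comp_sub_const s s (by rw [sub_self]; exact hl)).congr_of_eventuallyEq
          (Eventually.of_forall fun r =>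
            congrArg (fun p => sesqRe 1 (φ p) (φ p)) (e r).symm)) t
    refine key.congr_deriv ?_
    have hdiv (x) := eq_neg_of_add_eq_zero_left (h (t, x)).divergence_eq_zero
    simp only [hdiv]
    rw [integral_neg, integral_finsetSum _ fun j _ =>
      hint _ (hcont (0, EuclideanSpace.single j 1) _) (fun s x hx => by simp [hsupp s x hx]) t]
    simp only [hspace, Finset.sum_const_zero, neg_zero]
  simp only [← sesqRe_one_self]
  exact is_const_of_deriv_eq_zero (fun s => (htime s).differentiableAt)
    (fun s => (htime s).deriv) t 0

/-- Lemma 2.1: if `ψ` is `C¹`, compactly supported in space, and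
solves the Dirac equation with a continuous real scalar potential `V`, then for
every `z ∈ ℂ` the `L²` norm of `ψ(t) + z γ² ψ*(t)` is conserved in time. -/
theorem majorana_L2_conservation (M : ℝ) (V : Spacetime → ℝ)
    (hV : Continuous V) (ψ : Spacetime → Fin 4 → ℂ) (hψ : ContDiff ℝ 1 ψ)
    (hsupp : ∃ R > 0, ∀ (t : ℝ) (x : EuclideanSpace ℝ (Fin 3)),
      R ≤ ‖x‖ → ψ (t, x) = 0)
    (heq : ∀ p, diracOp M ψ p = (V p : ℂ) • ψ p) :
    ∀ (z : ℂ) (t : ℝ),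
      (∫ x : EuclideanSpace ℝ (Fin 3),
          ∑ i, Complex.normSq ((ψ (t, x) + z • (γ2 *ᵥ star (ψ (t, x)))) i))
        = ∫ x : EuclideanSpace ℝ (Fin 3),
            ∑ i, Complex.normSq ((ψ (0, x) + z • (γ2 *ᵥ star (ψ (0, x)))) i) := by
  intro z t
  obtain ⟨R, -, hR⟩ := hsupp
  have hfd (p v : Spacetime) : fderiv ℝ (fun p => majoranaMap z (ψ p)) p v
      = majoranaMap z (fderiv ℝ ψ p v) :=
    DFunLike.congr_fun ((majoranaMap z).hasFDerivAt.comp p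
      (hψ.differentiable one_ne_zero p).hasFDerivAt).fderiv v
  have key := integral_normSq_eq_of_diracRelation (φ := fun p => majoranaMap z (ψ p))
    ((majoranaMap z).contDiff.comp hψ) (R := R) (fun s x hx => by simp [hR s x hx])
    (m := fun p => M - V p) (fun p => by
      simp only [hfd]
      refine DiracRelation.majoranaMap ?_ z
      have hp := heq p
      rw [diracOp] at hp
      rw [DiracRelation, ofReal_sub, sub_smul, ← add_sub_assoc, hp, sub_self]) t
  exact key
end
end

section
/- Let M ∈ ℝ and let φ, χ : ℝ × ℝ³ → ℂ⁴ be differentiable and solve the coupled system −i γ⁰ ∂_t φ − i ∑_{j=1}^{3} γ^j ∂_{x_j} φ + M φ = (φ† γ⁰ χ + χ† γ⁰ φ) φ and −i γ⁰ ∂_t χ − i ∑_{j=1}^{3} γ^j ∂_{x_j} χ + M χ = (φ† γ⁰ χ + χ† γ⁰ φ) χ pointwise, and suppose that φ† γ⁰ φ = 0 and χ† γ⁰ χ = 0 at every point. Then ψ := φ + χ solves the cubic Dirac equation (Soler model): −i γ⁰ ∂_t ψ − i ∑_{j=1}^{3} γ^j ∂_{x_j} ψ + M ψ = (ψ† γ⁰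 ψ) ψ pointwise. -/
open Matrix Complex

noncomputable section

/-- The Dirac operator is additive on differentiable spinor fields. -/
theorem diracOp_add (M : ℝ) {φ χ : Spacetime → Fin 4 → ℂ} {p : Spacetime}
    (hφ : DifferentiableAt ℝ φ p) (hχ : DifferentiableAt ℝ χ p) :
    diracOp M (fun q => φ q + χ q) p = diracOp M φ p + diracOp M χ p := by
  have h : fderiv ℝ (fun q => φ q + χ q) p = fderiv ℝ φ p + fderiv ℝ χ p :=
    fderiv_fun_add hφ hχ
  simp only [diracOp, h, _root_.add_apply, mulVec_add, Finset.sum_add_distrib, smul_add]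
  abel

/-- if `φ, χ` are differentiable solutions of the coupled system
with coupling `φ† γ⁰ χ + χ† γ⁰ φ` and `φ† γ⁰ φ = 0 = χ† γ⁰ χ` everywhere,
then `ψ = φ + χ` solves the cubic Dirac equation (Soler model). -/
theorem sum_solves_cubic_dirac (M : ℝ) (φ χ : Spacetime → Fin 4 → ℂ)
    (hφ : Differentiable ℝ φ) (hχ : Differentiable ℝ χ)
    (heqφ : ∀ p, diracOp M φ p
      = (star (φ p) ⬝ᵥ (γ0 *ᵥ χ p) + star (χ p) ⬝ᵥ (γ0 *ᵥ φ p)) • φ p)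
    (heqχ : ∀ p, diracOp M χ p
      = (star (φ p) ⬝ᵥ (γ0 *ᵥ χ p) + star (χ p) ⬝ᵥ (γ0 *ᵥ φ p)) • χ p)
    (hnullφ : ∀ p, star (φ p) ⬝ᵥ (γ0 *ᵥ φ p) = 0)
    (hnullχ : ∀ p, star (χ p) ⬝ᵥ (γ0 *ᵥ χ p) = 0) :
    ∀ p, diracOp M (fun q => φ q + χ q) p
      = (star (φ p + χ p) ⬝ᵥ (γ0 *ᵥ (φ p + χ p))) • (φ p + χ p) := by
  intro p
  rw [diracOp_add M (hφ p) (hχ p), heqφ p, heqχ p, ← smul_add]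
  congr 1
  simp only [star_add, mulVec_add, add_dotProduct, dotProduct_add, hnullφ p, hnullχ p]
  ring
end
end
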